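/- Let f : {±1}^n → {0,1} be the indicator of an intersection of k halfspaces (k ≥ 2) and let ε ∈ (0,1). Then there exists an absolute constant C such that the Fourier mass above degree C·log(k)/ε² is at most ε: Σ_{S : |S| > C log(k) ε^{-2}} |f̂(S)|^2 < ε. -/

import Mathlib

open Real Finset

noncomputable def sgn (b : Bool) : ℝ := if b then 1 else -1

def flip' {n : ℕ} (x : Fin n → Bool) (i : Fin n) : Fin n → Bool :=
  Function.update x i (!x i)

noncomputable def expect {n : ℕ} (f : (Fin n → Bool) → ℝ) : ℝ :=
  (∑ x : Fin n → Bool, f x) / 2 ^ n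

noncomputable def avgSens {n : ℕ} (f : (Fin n → Bool) → ℝ) : ℝ :=
  (∑ x : Fin n → Bool, ∑ i : Fin n,
    if f x ≠ f (flip' x i) then (1 : ℝ) else 0) / 2 ^ n

/-- `f` is monotone nondecreasing in coordinate `i` (where `true ↦ +1`, `false ↦ -1`). -/
def MonoIn {n : ℕ} (f : (Fin n → Bool) → ℝ) (i : Fin n) : Prop :=
  ∀ x, f (Function.update x i false) ≤ f (Function.update x i true)

/-- `f` is monotone nonincreasing in coordinate `i`. -/
def AntiIn {n : ℕ} (f : (Fin n → Bool) → ℝ) (i : Fin n) : Prop :=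
  ∀ x, f (Function.update x i true) ≤ f (Function.update x i false)

def Unate {n : ℕ} (f : (Fin n → Bool) → ℝ) : Prop :=
  ∀ i, MonoIn f i ∨ AntiIn f i

noncomputable def noiseSens {n : ℕ} (ε : ℝ) (f : (Fin n → Bool) → ℝ) : ℝ :=
  (∑ x : Fin n → Bool, ∑ s : Fin n → Bool,
    (∏ i : Fin n, if s i then ε else 1 - ε) *
      (if f x ≠ f (fun i => xor (s i) (x i)) then (1 : ℝ) else 0)) / 2 ^ n

noncomputable def walshCoeff {n : ℕ} (f : (Fin n → Bool) → ℝ)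
    (S : Finset (Fin n)) : ℝ :=
  expect (fun x => f x * ∏ i ∈ S, sgn (x i))


/-- total (unnormalised) sensitivity of a predicate -/
noncomputable def tSens {n : ℕ} (A : (Fin n → Bool) → Prop) : ℝ :=
  open Classical in
  ∑ i : Fin n, ∑ x : Fin n → Bool, if (A x ↔ A (flip' x i)) then (0 : ℝ) else 1

lemma flip2_self {n : ℕ} (x : Fin n → Bool) (i : Fin n) : flip' (flip' x i) i = x := by
  unfold flip'
  simp

lemma sgn_not (b : Bool) : sgn (!b) = - sgn b := by
  cases b <;> simp [sgn]

lemma sum_flip {n : ℕ} (g : (Fin n → Bool) → ℝ) (i : Fin n) :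
    ∑ x, g (flip' x i) = ∑ x, g x := by
  have hinv : Function.Involutive (fun x : Fin n → Bool => flip' x i) :=
    fun x => flip2_self x i
  exact Equiv.sum_comp hinv.toPerm g

open Classical in
lemma step {n : ℕ} (A H : (Fin n → Bool) → Prop) (c : Fin n → ℝ)
    (hc : ∀ i, c i = 1 ∨ c i = -1)
    (hH : ∀ x i, ¬ H x → H (flip' x i) → c i * sgn (x i) = 1) :
    tSens (fun x => A x ∧ H x) ≤ tSens A +
      2 * ∑ x, (if A x ∧ ¬ H x then ∑ i, c i * sgn (x i) else 0) := by
  have h1 : 2 * ∑ x, (if A x ∧ ¬ H x then ∑ i, c i * sgn (x i) else 0)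
      = ∑ i, ∑ x, ((if A x ∧ ¬ H x then c i * sgn (x i) else 0)
        + (if A (flip' x i) ∧ ¬ H (flip' x i) then c i * sgn (flip' x i i) else 0)) := by
    have : ∀ i, ∑ x, ((if A x ∧ ¬ H x then c i * sgn (x i) else 0)
        + (if A (flip' x i) ∧ ¬ H (flip' x i) then c i * sgn (flip' x i i) else 0))
        = 2 * ∑ x, (if A x ∧ ¬ H x then c i * sgn (x i) else 0) := by
      intro i
      rw [Finset.sum_add_distrib,
        sum_flip (fun x => if A x ∧ ¬ H x then c i * sgn (x i) else 0) i]
      ring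
    simp_rw [this]
    rw [← Finset.mul_sum, Finset.sum_comm]
    congr 1
    apply Finset.sum_congr rfl
    intro x _
    split_ifs <;> simp
  rw [h1]
  unfold tSens
  rw [← Finset.sum_add_distrib]
  apply Finset.sum_le_sum
  intro i _
  rw [← Finset.sum_add_distrib]
  apply Finset.sum_le_sum
  intro x _
  have e1 := hH x i
  have e2 := hH (flip' x i) i
  rw [flip2_self] at e2
  have e3 : sgn (flip' x i i) = - sgn (x i) := by
    simp [flip', sgn_not]
  rw [e3] at e2 ⊢
  have e4 : c i * sgn (x i) = 1 ∨ c i * sgn (x i) = -1 := by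
    rcases hc i with h | h <;> cases x i <;> simp [h, sgn]
  rw [mul_neg] at e2 ⊢
  generalize c i * sgn (x i) = y at *
  generalize flip' x i = x' at *
  by_cases a : A x <;> by_cases a' : A x' <;> by_cases b : H x <;> by_cases b' : H x' <;>
    simp only [a, a', b, b', not_true, not_false_iff, true_and, and_true, false_and, and_false,
      if_true, if_false, iff_true, iff_false, true_iff, false_iff, iff_self, true_imp_iff,
      false_imp_iff] at * <;>
    rcases e4 with h | h <;> linarith

open Classical in
lemma exists_Z {n k : ℕ} (lam : ℝ) (H : Fin k → (Fin n → Bool) → Prop) (c : Fin k → Fin n → ℝ)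
    (hc : ∀ j i, c j i = 1 ∨ c j i = -1)
    (hH : ∀ j x i, ¬ H j x → H j (flip' x i) → c j i * sgn (x i) = 1) (s : Finset (Fin k)) :
    ∃ Z : (Fin n → Bool) → ℝ, (∀ x, (∀ j ∈ s, H j x) → Z x = 0) ∧
      (∀ x, exp (lam * Z x) ≤ 1 + ∑ j ∈ s, exp (lam * ∑ i, c j i * sgn (x i))) ∧
      tSens (fun x => ∀ j ∈ s, H j x) ≤ 2 * ∑ x, Z x := by
  induction s using Finset.induction_on with
  | empty =>
    refine ⟨fun _ => 0, ?_, ?_, ?_⟩ <;> simp [tSens]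
  | insert a s ha ih =>
    obtain ⟨Z, h1, h2, h3⟩ := ih
    refine ⟨fun x => Z x + if (∀ j ∈ s, H j x) ∧ ¬ H a x then ∑ i, c a i * sgn (x i) else 0,
      ?_, ?_, ?_⟩
    · intro x hx
      have : H a x := hx a (Finset.mem_insert_self _ _)
      simp only [this, not_true, and_false, if_false, add_zero]
      exact h1 x fun j hj => hx j (Finset.mem_insert_of_mem hj)
    · intro x
      rw [Finset.sum_insert ha]
      dsimp only
      split_ifs with h
      · rw [h1 x h.1, zero_add]
        have : 0 ≤ ∑ j ∈ s, exp (lam * ∑ i, c j i * sgn (x i)) :=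
          Finset.sum_nonneg fun _ _ => (exp_pos _).le
        linarith
      · rw [add_zero]
        have := h2 x
        have := exp_pos (lam * ∑ i, c a i * sgn (x i))
        linarith
    · have := step (fun x => ∀ j ∈ s, H j x) (H a) (c a) (hc a) (hH a)
      have e : (fun x => ∀ j ∈ insert a s, H j x) = fun x => (∀ j ∈ s, H j x) ∧ H a x := by
        funext x
        simp [and_comm]
      rw [e, Finset.sum_add_distrib, mul_add]
      refine (this.trans (add_le_add_left h3 _)).trans (le_of_eq ?_)
      congr!

lemma sum_prod_bool {n : ℕ} (f : Fin n → Bool → ℝ) :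
    ∑ x : Fin n → Bool, ∏ i, f i (x i) = ∏ i, (f i true + f i false) := by
  have := (Finset.prod_univ_sum (fun _ : Fin n => (Finset.univ : Finset Bool)) f).symm
  simpa only [Fintype.piFinset_univ, Fintype.sum_bool] using this

lemma mgf {n : ℕ} (lam : ℝ) (c : Fin n → ℝ) (hc : ∀ i, c i = 1 ∨ c i = -1) :
    ∑ x : Fin n → Bool, exp (lam * ∑ i, c i * sgn (x i)) ≤ 2 ^ n * exp (n * (lam ^ 2 / 2)) := by
  have h : ∀ x : Fin n → Bool, exp (lam * ∑ i, c i * sgn (x i))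
      = ∏ i, (fun (i : Fin n) (b : Bool) => exp (lam * (c i * sgn b))) i (x i) := by
    intro x
    rw [Finset.mul_sum, Real.exp_sum]
  simp_rw [h]
  rw [sum_prod_bool (fun (i : Fin n) (b : Bool) => exp (lam * (c i * sgn b)))]
  have h2 : ∀ i ∈ (Finset.univ : Finset (Fin n)),
      exp (lam * (c i * sgn true)) + exp (lam * (c i * sgn false)) ≤ 2 * exp (lam ^ 2 / 2) := by
    intro i _
    have := Real.cosh_le_exp_half_sq lam
    rw [Real.cosh_eq] at this
    rcases hc i with h | h <;> simp [h, sgn] <;> linarith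
  refine (Finset.prod_le_prod (fun i _ => by positivity) h2).trans ?_
  simp [mul_pow, ← Real.exp_nat_mul]

lemma tSens_le {n k : ℕ} (hn : 0 < n) (hk : 2 ≤ k) (w : Fin k → Fin n → ℝ) (θ : Fin k → ℝ) :
    tSens (fun x => ∀ j, θ j ≤ ∑ i : Fin n, w j i * sgn (x i))
      ≤ 2 ^ n * (4 * √(n * Real.log k)) := by
  have hL : 0 < Real.log k := Real.log_pos (by exact_mod_cast hk)
  have hn' : (0:ℝ) < n := by exact_mod_cast hn
  set r := √(n * Real.log k) with hr
  have hr0 : 0 < r := Real.sqrt_pos.2 (by positivity)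
  have hr2 : r ^ 2 = n * Real.log k := Real.sq_sqrt (by positivity)
  obtain ⟨lam, hlam⟩ : ∃ lam, lam = 2 * r / n := ⟨_, rfl⟩
  have hl0 : 0 < lam := by rw [hlam]; positivity
  obtain ⟨Z, -, h2, h3⟩ := exists_Z lam (fun j x => θ j ≤ ∑ i : Fin n, w j i * sgn (x i))
    (fun j i => if 0 ≤ w j i then -1 else 1) (by intro j i; split_ifs <;> simp) (by
      intro j x i h h'
      have hd : ∑ i' : Fin n, w j i' * sgn (flip' x i i') - ∑ i' : Fin n, w j i' * sgn (x i')
          = - 2 * (w j i * sgn (x i)) := by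
        rw [← Finset.sum_sub_distrib, Finset.sum_eq_single i]
        · simp [flip', sgn_not]; ring
        · intro b _ hb
          simp [flip', Function.update_of_ne hb]
        · simp
      have hneg : w j i * sgn (x i) < 0 := by linarith
      cases hx : x i <;> simp only [hx, sgn, if_true, Bool.false_eq_true, if_false] at hneg ⊢ <;>
        split_ifs <;> linarith) Finset.univ
  simp only [Finset.mem_univ, true_imp_iff] at h3
  refine h3.trans ?_
  set E := exp (n * (lam ^ 2 / 2)) with hE
  have hE1 : 1 ≤ E := Real.one_le_exp (by positivity)
  have hsum : ∑ x, exp (lam * Z x) ≤ 2 ^ n * ((k + 1) * E) := by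
    refine (Finset.sum_le_sum fun x _ => h2 x).trans ?_
    rw [Finset.sum_add_distrib, Finset.sum_comm]
    have : ∑ j : Fin k, ∑ x : Fin n → Bool,
        exp (lam * ∑ i, (fun j i => if 0 ≤ w j i then (-1:ℝ) else 1) j i * sgn (x i))
        ≤ ∑ j : Fin k, 2 ^ n * E := by
      apply Finset.sum_le_sum
      intro j _
      exact mgf lam _ (by intro i; dsimp only; split_ifs <;> simp)
    simp only [Finset.sum_const, Finset.card_univ, Fintype.card_fin, nsmul_eq_mul] at this
    have h1 : ∑ x : Fin n → Bool, (1:ℝ) = 2 ^ n := by simp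
    rw [h1]
    have h2n : (0:ℝ) < 2 ^ n := by positivity
    nlinarith
  set M := ((k:ℝ) + 1) * E with hM
  have hM0 : 0 < M := by positivity
  have hpt : ∀ x, lam * Z x ≤ exp (lam * Z x) / M + (Real.log M - 1) := by
    intro x
    have := Real.add_one_le_exp (lam * Z x - Real.log M)
    rw [Real.exp_sub, Real.exp_log hM0] at this
    linarith
  have hsum2 : lam * ∑ x, Z x ≤ 2 ^ n * Real.log M := by
    rw [Finset.mul_sum]
    refine (Finset.sum_le_sum fun x _ => hpt x).trans ?_
    rw [Finset.sum_add_distrib, ← Finset.sum_div]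
    have : (∑ x, exp (lam * Z x)) / M ≤ 2 ^ n := by
      rw [div_le_iff₀ hM0]; exact hsum
    simp only [Finset.sum_const, Finset.card_univ, Fintype.card_fun, Fintype.card_fin,
      Fintype.card_bool, nsmul_eq_mul]
    push_cast
    linarith
  have hlogM : Real.log M ≤ 2 * Real.log k + n * (lam ^ 2 / 2) := by
    rw [hM, Real.log_mul (by positivity) (by positivity), hE, Real.log_exp]
    have : Real.log (k + 1) ≤ Real.log ((k:ℝ) ^ 2) := by
      apply Real.log_le_log (by positivity)
      have : (2:ℝ) ≤ k := by exact_mod_cast hk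
      nlinarith
    rw [Real.log_pow] at this
    push_cast at this
    linarith
  have hfin : 2 * Real.log k + n * (lam ^ 2 / 2) = lam * (2 * r) := by
    have : Real.log k = r ^ 2 / n := by rw [hr2]; field_simp
    rw [this, hlam]
    field_simp
    ring
  have : lam * ∑ x, Z x ≤ lam * (2 ^ n * (2 * r)) := by
    refine hsum2.trans ?_
    rw [hfin] at hlogM
    have h2n : (0:ℝ) < 2 ^ n := by positivity
    nlinarith
  have := le_of_mul_le_mul_left this hl0
  linarith

lemma sgn_sq (b : Bool) : sgn b * sgn b = 1 := by
  cases b <;> simp [sgn]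

lemma sgn_beq (a b : Bool) : sgn (a == b) = sgn a * sgn b := by
  cases a <;> cases b <;> simp [sgn]

lemma parseval {n : ℕ} (f : (Fin n → Bool) → ℝ) :
    ∑ S, walshCoeff f S ^ 2 = (∑ x, f x ^ 2) / 2 ^ n := by
  have h2n : (2:ℝ) ^ n ≠ 0 := by positivity
  have key : ∀ x y : Fin n → Bool, ∑ S : Finset (Fin n), (∏ i ∈ S, sgn (x i)) * ∏ i ∈ S, sgn (y i)
      = if x = y then 2 ^ n else 0 := by
    intro x y
    simp_rw [← Finset.prod_mul_distrib]
    have := Finset.prod_one_add (f := fun i => sgn (x i) * sgn (y i)) (Finset.univ : Finset (Fin n))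
    rw [Finset.powerset_univ] at this
    rw [← this]
    split_ifs with h
    · subst h
      simp_rw [sgn_sq]
      norm_num
    · obtain ⟨i, hi⟩ := Function.ne_iff.1 h
      apply Finset.prod_eq_zero (Finset.mem_univ i)
      revert hi
      cases x i <;> cases y i <;> simp [sgn]
  have : ∀ S : Finset (Fin n), walshCoeff f S ^ 2 =
      (∑ x, ∑ y, f x * f y * ((∏ i ∈ S, sgn (x i)) * ∏ i ∈ S, sgn (y i))) / (2 ^ n * 2 ^ n) := by
    intro S
    unfold walshCoeff _root_.expect
    rw [div_pow, sq, sq, Finset.sum_mul_sum]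
    congr 1
    refine Finset.sum_congr rfl fun x _ => Finset.sum_congr rfl fun y _ => ?_
    ring
  simp_rw [this]
  rw [← Finset.sum_div, Finset.sum_comm]
  have : ∀ x, ∑ S : Finset (Fin n), ∑ y,
      f x * f y * ((∏ i ∈ S, sgn (x i)) * ∏ i ∈ S, sgn (y i)) = f x ^ 2 * 2 ^ n := by
    intro x
    rw [Finset.sum_comm]
    simp_rw [← Finset.mul_sum, key]
    simp
    ring
  simp_rw [this]
  rw [← Finset.sum_mul]
  field_simp

/-- flip block `l` of the partition `bl` -/
def bflip {n m : ℕ} (bl : Fin n → Fin m) (l : Fin m) (z : Fin n → Bool) : Fin n → Bool :=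
  fun i => if bl i = l then !z i else z i

lemma bflip2 {n m : ℕ} (bl : Fin n → Fin m) (l : Fin m) (z : Fin n → Bool) :
    bflip bl l (bflip bl l z) = z := by
  funext i
  unfold bflip
  split_ifs <;> simp

lemma sum_bflip {n m : ℕ} (bl : Fin n → Fin m) (l : Fin m) (g : (Fin n → Bool) → ℝ) :
    ∑ x, g (bflip bl l x) = ∑ x, g x := by
  have hinv : Function.Involutive (fun x : Fin n → Bool => bflip bl l x) :=
    fun x => bflip2 bl l x
  exact Equiv.sum_comp hinv.toPerm g

lemma sum_beq {n : ℕ} (y : Fin n → Bool) (g : (Fin n → Bool) → ℝ) :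
    ∑ x : Fin n → Bool, g (fun i => x i == y i) = ∑ x, g x := by
  have hinv : Function.Involutive (fun x : Fin n → Bool => fun i => x i == y i) := by
    intro x
    funext i
    dsimp only
    cases x i <;> cases y i <;> rfl
  exact Equiv.sum_comp hinv.toPerm g

/-- block character -/
noncomputable def bchi {n m : ℕ} (bl : Fin n → Fin m) (l : Fin m) (S : Finset (Fin n)) : ℝ :=
  ∏ i ∈ S, if bl i = l then (-1 : ℝ) else 1

lemma bchi_sq {n m : ℕ} (bl : Fin n → Fin m) (l : Fin m) (S : Finset (Fin n)) :
    bchi bl l S * bchi bl l S = 1 := by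
  unfold bchi
  rw [← Finset.prod_mul_distrib]
  apply Finset.prod_eq_one
  intro i _
  split_ifs <;> norm_num

lemma chi_bflip {n m : ℕ} (bl : Fin n → Fin m) (l : Fin m) (S : Finset (Fin n))
    (z : Fin n → Bool) :
    ∏ i ∈ S, sgn (bflip bl l z i) = bchi bl l S * ∏ i ∈ S, sgn (z i) := by
  unfold bchi
  rw [← Finset.prod_mul_distrib]
  apply Finset.prod_congr rfl
  intro i _
  unfold bflip
  split_ifs <;> simp [sgn_not]

lemma walsh_diff {n m : ℕ} (bl : Fin n → Fin m) (l : Fin m) (f : (Fin n → Bool) → ℝ) :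
    (∑ z, (f z - f (bflip bl l z)) ^ 2) / 2 ^ n
      = ∑ S, 2 * walshCoeff f S ^ 2 * (1 - bchi bl l S) := by
  rw [← parseval (fun z => f z - f (bflip bl l z))]
  apply Finset.sum_congr rfl
  intro S _
  have : walshCoeff (fun z => f z - f (bflip bl l z)) S = walshCoeff f S * (1 - bchi bl l S) := by
    unfold walshCoeff _root_.expect
    simp_rw [sub_mul]
    rw [Finset.sum_sub_distrib]
    have h := sum_bflip bl l (fun z => f (bflip bl l z) * ∏ i ∈ S, sgn (z i))
    simp only [bflip2, chi_bflip] at h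
    rw [← h]
    have h3 : ∑ x, f x * (bchi bl l S * ∏ i ∈ S, sgn (x i))
        = bchi bl l S * ∑ x, f x * ∏ i ∈ S, sgn (x i) := by
      rw [Finset.mul_sum]
      exact Finset.sum_congr rfl fun x _ => by ring
    rw [h3]
    ring
  rw [this]
  have := bchi_sq bl l S
  linear_combination walshCoeff f S ^ 2 * this

lemma sum_bchi {n m : ℕ} (l : Fin m) (S : Finset (Fin n)) :
    ∑ bl : Fin n → Fin m, bchi bl l S = (m - 2) ^ S.card * (m:ℝ) ^ (n - S.card) := by
  have h : ∀ bl : Fin n → Fin m, bchi bl l S =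
      ∏ i, (fun (i : Fin n) (b : Fin m) => if i ∈ S then (if b = l then (-1 : ℝ) else 1) else 1)
        i (bl i) := by
    intro bl
    unfold bchi
    simp [Finset.prod_ite_mem]
  simp_rw [h]
  have := (Finset.prod_univ_sum (fun _ : Fin n => (Finset.univ : Finset (Fin m)))
    (fun (i : Fin n) (b : Fin m) => if i ∈ S then (if b = l then (-1 : ℝ) else 1) else 1)).symm
  rw [Fintype.piFinset_univ] at this
  rw [this]
  have h1 : ∀ i : Fin n, ∑ b : Fin m, (if i ∈ S then (if b = l then (-1 : ℝ) else 1) else 1)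
      = if i ∈ S then (m:ℝ) - 2 else m := by
    intro i
    split_ifs
    · have : ∀ b : Fin m, (if b = l then (-1 : ℝ) else 1) = 1 - (if b = l then 2 else 0) := by
        intro b; split_ifs <;> norm_num
      simp_rw [this]
      rw [Finset.sum_sub_distrib]
      simp
    · simp
  simp_rw [h1]
  rw [Finset.prod_ite]
  simp [Finset.filter_not, Finset.card_sdiff]

lemma sum_bchi_le {n m : ℕ} (hm : 2 ≤ m) (l : Fin m) (S : Finset (Fin n)) (hS : m ≤ S.card) :
    ∑ bl : Fin n → Fin m, bchi bl l S ≤ (m:ℝ) ^ n / 2 := by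
  rw [sum_bchi]
  have hm' : (2:ℝ) ≤ m := by exact_mod_cast hm
  have hc : S.card ≤ n := by simpa using Finset.card_le_univ S
  have e : (m:ℝ) ^ n = (m:ℝ) ^ S.card * (m:ℝ) ^ (n - S.card) := by
    rw [← pow_add]; congr 1; omega
  have h1 : ((m:ℝ) - 2) ^ S.card ≤ (m:ℝ) ^ S.card / 2 := by
    have h2 : (m:ℝ) - 2 ≤ m * exp (-(2 / m)) := by
      have := Real.add_one_le_exp (-(2 / (m:ℝ)))
      have h3 : (m:ℝ) - 2 = m * (-(2/m) + 1) := by field_simp; ring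
      rw [h3]
      gcongr
    have h4 : exp (-(2 / (m:ℝ))) ^ S.card ≤ 1 / 2 := by
      rw [← Real.exp_nat_mul]
      have h5 : (2:ℝ) ≤ S.card * (2 / m) := by
        have : (m:ℝ) ≤ S.card := by exact_mod_cast hS
        rw [mul_div_assoc', le_div_iff₀ (by linarith)]
        linarith
      have h6 : exp ((S.card:ℝ) * (-(2 / (m:ℝ)))) ≤ exp (-1) := by
        apply Real.exp_le_exp.2; linarith
      refine h6.trans ?_
      rw [Real.exp_neg, one_div]
      apply inv_anti₀ (by norm_num)
      have := Real.add_one_le_exp (1:ℝ)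
      linarith
    calc ((m:ℝ) - 2) ^ S.card ≤ (m * exp (-(2 / m))) ^ S.card :=
          pow_le_pow_left₀ (by linarith) h2 _
      _ = (m:ℝ) ^ S.card * exp (-(2 / m)) ^ S.card := mul_pow _ _ _
      _ ≤ (m:ℝ) ^ S.card * (1 / 2) := by gcongr
      _ = _ := by ring
  rw [e]
  have : (0:ℝ) ≤ (m:ℝ) ^ (n - S.card) := by positivity
  nlinarith

open Classical in
lemma block_le {n m k : ℕ} (hm : 0 < m) (hk : 2 ≤ k) (w : Fin k → Fin n → ℝ) (θ : Fin k → ℝ)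
    (bl : Fin n → Fin m) (F : (Fin n → Bool) → Prop)
    (hF : F = fun x => ∀ j, θ j ≤ ∑ i : Fin n, w j i * sgn (x i)) :
    ∑ l : Fin m, ∑ z : Fin n → Bool, (if (F z ↔ F (bflip bl l z)) then (0:ℝ) else 1)
      ≤ 2 ^ n * (4 * √(m * Real.log k)) := by
  have h1 : ∀ z : Fin n → Bool, tSens (fun y : Fin m → Bool => F (fun i => z i == y (bl i)))
      ≤ 2 ^ m * (4 * √(m * Real.log k)) := by
    intro z
    have := tSens_le hm hk
      (fun j l => ∑ i ∈ Finset.univ.filter (fun i => bl i = l), w j i * sgn (z i)) θ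
    convert this using 4 with y
    rw [hF]
    apply forall_congr'
    intro j
    have : ∑ i, w j i * sgn (z i == y (bl i)) =
        ∑ l, (∑ i ∈ Finset.univ.filter (fun i => bl i = l), w j i * sgn (z i)) * sgn (y l) := by
      rw [← Finset.sum_fiberwise Finset.univ bl]
      apply Finset.sum_congr rfl
      intro l _
      rw [Finset.sum_mul]
      apply Finset.sum_congr rfl
      intro i hi
      rw [Finset.mem_filter] at hi
      rw [sgn_beq, hi.2]
      ring
    rw [this]
  have h2 : ∑ z : Fin n → Bool, tSens (fun y : Fin m → Bool => F (fun i => z i == y (bl i)))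
      = 2 ^ m * ∑ l : Fin m, ∑ z : Fin n → Bool,
        (if (F z ↔ F (bflip bl l z)) then (0:ℝ) else 1) := by
    unfold tSens
    rw [Finset.sum_comm, Finset.mul_sum]
    apply Finset.sum_congr rfl
    intro l _
    rw [Finset.sum_comm]
    have : ∀ y : Fin m → Bool, ∑ z : Fin n → Bool,
        (if (F (fun i => z i == y (bl i)) ↔ F (fun i => z i == flip' y l (bl i))) then (0:ℝ) else 1)
        = ∑ z : Fin n → Bool, (if (F z ↔ F (bflip bl l z)) then (0:ℝ) else 1) := by
      intro y
      rw [← sum_beq (fun i => y (bl i)) (fun z => if (F z ↔ F (bflip bl l z)) then (0:ℝ) else 1)]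
      apply Finset.sum_congr rfl
      intro z _
      have : bflip bl l (fun i => z i == y (bl i)) = fun i => z i == flip' y l (bl i) := by
        funext i
        unfold bflip flip'
        by_cases h : bl i = l
        · simp only [h, if_true, Function.update_self]
          cases z i <;> cases y l <;> rfl
        · simp [h]
      rw [this]
    simp_rw [this]
    simp
  have h3 := Finset.sum_le_sum fun z (_ : z ∈ Finset.univ) => h1 z
  rw [h2] at h3
  simp only [Finset.sum_const, Finset.card_univ, Fintype.card_fun, Fintype.card_fin,
      Fintype.card_bool, nsmul_eq_mul] at h3
  push_cast at h3
  have h2m : (0:ℝ) < 2 ^ m := by positivity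
  refine le_of_mul_le_mul_left (h3.trans (le_of_eq ?_)) h2m
  ring

lemma mass_le {n m k : ℕ} (hm : 2 ≤ m) (hk : 2 ≤ k) (w : Fin k → Fin n → ℝ) (θ : Fin k → ℝ)
    (f : (Fin n → Bool) → ℝ)
    (hf : f = fun x => if ∀ j, θ j ≤ ∑ i : Fin n, w j i * sgn (x i) then (1 : ℝ) else 0)
    (T : Finset (Finset (Fin n))) (hT : ∀ S ∈ T, m ≤ S.card) :
    m * ∑ S ∈ T, walshCoeff f S ^ 2 ≤ 4 * √(m * Real.log k) := by
  classical
  have hm' : (0:ℝ) < m := by exact_mod_cast (by omega : 0 < m)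
  have h1 : ∀ bl : Fin n → Fin m, ∑ l, ∑ S, 2 * walshCoeff f S ^ 2 * (1 - bchi bl l S)
      ≤ 4 * √(m * Real.log k) := by
    intro bl
    simp_rw [← walsh_diff]
    rw [← Finset.sum_div, div_le_iff₀ (by positivity), mul_comm]
    refine le_trans (le_of_eq ?_) (block_le (by omega) hk w θ bl _ rfl)
    refine Finset.sum_congr rfl fun l _ => Finset.sum_congr rfl fun z _ => ?_
    rw [hf]
    dsimp only
    by_cases hP : (∀ j, θ j ≤ ∑ i : Fin n, w j i * sgn (z i)) <;>
      by_cases hQ : (∀ j, θ j ≤ ∑ i : Fin n, w j i * sgn (bflip bl l z i))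
    · rw [if_pos hP, if_pos hQ, if_pos (iff_of_true hP hQ)]; norm_num
    · rw [if_pos hP, if_neg hQ, if_neg (fun h => hQ (h.1 hP))]; norm_num
    · rw [if_neg hP, if_pos hQ, if_neg (fun h => hP (h.2 hQ))]; norm_num
    · rw [if_neg hP, if_neg hQ, if_pos (iff_of_false hP hQ)]; norm_num
  have h2 := Finset.sum_le_sum fun bl (_ : bl ∈ Finset.univ) => h1 bl
  simp only [Finset.sum_const, Finset.card_univ, Fintype.card_fun, Fintype.card_fin,
      nsmul_eq_mul] at h2
  push_cast at h2
  have h3 : (m:ℝ) ^ n * (m * ∑ S ∈ T, walshCoeff f S ^ 2) ≤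
      ∑ bl : Fin n → Fin m, ∑ l, ∑ S, 2 * walshCoeff f S ^ 2 * (1 - bchi bl l S) := by
    rw [Finset.sum_comm]
    have : ∀ l : Fin m, (m:ℝ) ^ n * ∑ S ∈ T, walshCoeff f S ^ 2 ≤
        ∑ bl : Fin n → Fin m, ∑ S, 2 * walshCoeff f S ^ 2 * (1 - bchi bl l S) := by
      intro l
      have hle : ∀ (bl : Fin n → Fin m) S, bchi bl l S ≤ 1 := by
        intro bl S
        have := bchi_sq bl l S
        nlinarith
      rw [Finset.sum_comm, Finset.mul_sum]
      refine le_trans (Finset.sum_le_sum fun S hS => ?_)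
        (Finset.sum_le_sum_of_subset_of_nonneg (Finset.subset_univ T) fun S _ _ => ?_)
      · rw [← Finset.mul_sum, Finset.sum_sub_distrib]
        have := sum_bchi_le hm l S (hT S hS)
        simp only [Finset.sum_const, Finset.card_univ, Fintype.card_fun, Fintype.card_fin,
          nsmul_eq_mul]
        push_cast
        nlinarith [sq_nonneg (walshCoeff f S)]
      · refine Finset.sum_nonneg fun bl _ => ?_
        have := hle bl S
        have : 0 ≤ 1 - bchi bl l S := by linarith
        positivity
    have := Finset.sum_le_sum fun l (_ : l ∈ (Finset.univ : Finset (Fin m))) => this l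
    simp only [Finset.sum_const, Finset.card_univ, Fintype.card_fin, nsmul_eq_mul] at this
    linarith
  exact le_of_mul_le_mul_left (h3.trans h2) (by positivity)

theorem stmt_15 :
    ∃ C : ℝ, 0 < C ∧ ∀ (n k : ℕ), 2 ≤ k →
      ∀ (w : Fin k → Fin n → ℝ) (θ : Fin k → ℝ) (ε : ℝ), ε ∈ Set.Ioo (0 : ℝ) 1 →
      ∑ S ∈ Finset.univ.filter
          (fun S : Finset (Fin n) => C * Real.log k / ε ^ 2 < S.card),
          (walshCoeff (fun x =>
            if ∀ j, θ j ≤ ∑ i : Fin n, w j i * sgn (x i) then (1 : ℝ) else 0)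
            S) ^ 2 < ε := by
  refine ⟨32, by norm_num, ?_⟩
  intro n k hk w θ ε hε
  have hL : 1 / 2 < Real.log k := by
    have h2 : Real.log 2 ≤ Real.log k :=
      Real.log_le_log (by norm_num) (by exact_mod_cast hk)
    have := Real.log_two_gt_d9
    linarith
  have hε0 := hε.1
  have hε1 := hε.2
  set A := Real.log k / ε ^ 2 with hA
  have hAL : Real.log k ≤ A := by
    rw [hA, le_div_iff₀ (by positivity)]
    have : ε ^ 2 ≤ 1 := by nlinarith
    nlinarith
  obtain ⟨m, hmdef⟩ : ∃ m, m = ⌊16 * A⌋₊ + 1 := ⟨_, rfl⟩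
  have hm1 : 16 * A < m := by
    rw [hmdef]; push_cast; exact Nat.lt_floor_add_one _
  have hm2 : (m:ℝ) ≤ 32 * A := by
    rw [hmdef]; push_cast
    have := Nat.floor_le (show 0 ≤ 16 * A by linarith)
    linarith
  have hm3 : 2 ≤ m := by
    have : (2:ℝ) ≤ m := by linarith
    exact_mod_cast this
  have hmpos : (0:ℝ) < m := by linarith
  have key := mass_le hm3 hk w θ _ rfl (Finset.univ.filter
          (fun S : Finset (Fin n) => 32 * Real.log k / ε ^ 2 < S.card)) (by
    intro S hS
    rw [Finset.mem_filter] at hS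
    have h := hS.2
    rw [mul_div_assoc] at h
    have : (m:ℝ) ≤ S.card := by linarith
    exact_mod_cast this)
  have hlt : 4 * √(m * Real.log k) < m * ε := by
    have : √(m * Real.log k) < m * ε / 4 := by
      rw [Real.sqrt_lt' (by positivity)]
      have h1 : Real.log k = A * ε ^ 2 := by rw [hA]; field_simp
      rw [h1]
      have : 0 < m * ε ^ 2 := by positivity
      nlinarith
    linarith
  exact lt_of_mul_lt_mul_left (key.trans_lt hlt) hmpos.le
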